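/- Suppose x* is a local minimizer of f : ℝⁿ → ℝ subject to c(x) = 0 and g(x) ≥ 0 (componentwise), with f, c, g continuously differentiable and the gradients of active constraints linearly independent at x*. Then there exist multipliers ψ ∈ ℝ^{mₑ} and λ ∈ ℝ^{mᵢ} with λ ≥ 0 such that ∇f(x*) = ∇c(x*)ᵀψ + ∇g(x*)ᵀλ and λᵢ·gᵢ(x*) = 0 for all i. -/

import Mathlib

open Matrix
open Set Filter Topology

/-- Linearly independent continuous linear functionals are jointly surjective. -/
theorem LinearIndependent.surjective_continuousLinearMap_pi {E ι : Type*} [Fintype ι]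
    [NormedAddCommGroup E] [NormedSpace ℝ E] {L : ι → E →L[ℝ] ℝ} (hL : LinearIndependent ℝ L) :
    Function.Surjective (ContinuousLinearMap.pi L) := by
  classical
  by_contra hsurj
  have hlt : LinearMap.range (ContinuousLinearMap.pi L : E →ₗ[ℝ] ι → ℝ) < ⊤ :=
    lt_top_iff_ne_top.2 fun h => hsurj (LinearMap.range_eq_top.1 h)
  obtain ⟨Λ, hΛ, hle⟩ := Submodule.exists_le_ker_of_lt_top _ hlt
  apply hΛ
  have hexp : ∀ v : ι → ℝ, Λ v = ∑ i, Λ (Pi.single i 1) * v i := fun v => by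
    conv_lhs => rw [pi_eq_sum_univ' v]
    simp [mul_comm]
  have hzero : ∀ i, Λ (Pi.single i 1) = 0 := by
    refine Fintype.linearIndependent_iff.1 hL _ ?_
    ext x
    have hx : Λ (ContinuousLinearMap.pi L x) = 0 := hle ⟨x, rfl⟩
    rw [hexp] at hx
    simpa using hx
  ext i
  simpa using hzero i

/-- Karush-Kuhn-Tucker conditions when all constraints are active at `x₀`: the constraints indexed
by `s` are equalities, the other ones are inequalities. -/
theorem IsLocalMinOn.exists_multipliers_of_linearIndependent {E ι : Type*} [Fintype ι]
    [NormedAddCommGroup E] [NormedSpace ℝ E] [CompleteSpace E] {φ : E → ℝ} {φ' : E →L[ℝ] ℝ}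
    {a : ι → E → ℝ} {a' : ι → E →L[ℝ] ℝ} {x₀ : E} {s : Set ι}
    (hmin : IsLocalMinOn φ {x | ∀ i, a i x₀ ≤ a i x ∧ (i ∈ s → a i x = a i x₀)} x₀)
    (ha : ∀ i, HasStrictFDerivAt (a i) (a' i) x₀) (hφ : HasStrictFDerivAt φ φ' x₀)
    (hind : LinearIndependent ℝ a') :
    ∃ Λ : ι → ℝ, (∀ i ∉ s, 0 ≤ Λ i) ∧ φ' = ∑ i, Λ i • a' i := by
  classical
  have heq : ∃ Λ : ι → ℝ, φ' = ∑ i, Λ i • a' i := by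
    have hextr : IsLocalExtrOn φ {x | ∀ i, a i x = a i x₀} x₀ :=
      Or.inl (hmin.on_subset fun x hx i => ⟨(hx i).ge, fun _ => hx i⟩)
    obtain ⟨Λ, Λ₀, hne, hsum⟩ := hextr.exists_multipliers_of_hasStrictFDerivAt ha hφ
    have hΛ₀ : Λ₀ ≠ 0 := by
      rintro rfl
      refine hne (Prod.ext (funext ?_) rfl)
      exact Fintype.linearIndependent_iff.1 hind Λ (by simpa using hsum)
    refine ⟨fun i => -(Λ₀⁻¹ * Λ i), ?_⟩
    have hφ' : Λ₀ • φ' = -∑ i, Λ i • a' i := eq_neg_of_add_eq_zero_right hsum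
    calc φ' = Λ₀⁻¹ • Λ₀ • φ' := (inv_smul_smul₀ hΛ₀ φ').symm
      _ = ∑ i, (-(Λ₀⁻¹ * Λ i)) • a' i := by
        ext x
        simp [hφ', Finset.mul_sum, mul_assoc]
  obtain ⟨Λ, hΛ⟩ := heq
  refine ⟨Λ, fun i hi => ?_, hΛ⟩
  obtain ⟨R₀, hR₀⟩ := LinearMap.exists_rightInverse_of_surjective
    (ContinuousLinearMap.pi a' : E →ₗ[ℝ] ι → ℝ)
    (LinearMap.range_eq_top.2 hind.surjective_continuousLinearMap_pi)
  let R : (ι → ℝ) →L[ℝ] E := LinearMap.toContinuousLinearMap R₀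
  have hR : ∀ v j, a' j (R v) = v j := fun v j =>
    congrFun (LinearMap.congr_fun hR₀ v) j
  let A : E → ι → ℝ := fun x j => a j x
  let p : (ι → ℝ) → E := fun z => x₀ + R z
  have hp0 : p 0 = x₀ := by simp [p]
  have hp : HasStrictFDerivAt p R 0 := R.hasStrictFDerivAt.const_add x₀
  have hB : HasStrictFDerivAt (A ∘ p)
      (ContinuousLinearEquiv.refl ℝ (ι → ℝ) : (ι → ℝ) →L[ℝ] ι → ℝ) 0 := by
    have hA : HasStrictFDerivAt A (ContinuousLinearMap.pi a') (p 0) := by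
      rw [hp0]; exact hasStrictFDerivAt_pi.2 ha
    have h := hA.comp 0 hp
    have hid : (ContinuousLinearMap.pi a').comp R =
        (ContinuousLinearEquiv.refl ℝ (ι → ℝ) : (ι → ℝ) →L[ℝ] ι → ℝ) := by
      refine ContinuousLinearMap.ext fun v => funext fun j => ?_
      exact hR v j
    rwa [hid] at h
  have hB0 : (A ∘ p) 0 = A x₀ := by simp [hp0]
  obtain ⟨γ, hγ0, hγ', hγA⟩ : ∃ γ : (ι → ℝ) → E, γ (A x₀) = x₀ ∧
      HasStrictFDerivAt γ R (A x₀) ∧ ∀ᶠ z in 𝓝 (A x₀), A (γ z) = z := by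
    have hinv0 := hB.localInverse_apply_image
    have hinv' := hB.to_localInverse
    have hright := hB.eventually_right_inverse
    rw [hB0] at hinv0 hinv' hright
    refine ⟨p ∘ hB.localInverse, by simp [hinv0, hp0], ?_, hright⟩
    exact HasStrictFDerivAt.comp (A x₀) (g' := R) (by rw [hinv0]; exact hp) hinv'
  let T : Set (ι → ℝ) := {z | ∀ j, A x₀ j ≤ z j ∧ (j ∈ s → z j = A x₀ j)}
  have hφγ : IsLocalMinOn (φ ∘ γ) T (A x₀) := by
    have htend : Tendsto γ (𝓝[T] (A x₀))
        (𝓝[{x | ∀ i, a i x₀ ≤ a i x ∧ (i ∈ s → a i x = a i x₀)}] x₀) := by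
      refine tendsto_nhdsWithin_iff.2 ⟨?_, ?_⟩
      · have := hγ'.hasFDerivAt.continuousAt.tendsto
        rw [hγ0] at this
        exact this.mono_left nhdsWithin_le_nhds
      · filter_upwards [self_mem_nhdsWithin, nhdsWithin_le_nhds hγA] with z hz hzA j
        have hj : a j (γ z) = z j := congrFun hzA j
        rw [hj]
        exact hz j
    filter_upwards [htend.eventually hmin] with z hz
    simpa [hγ0] using hz
  have hderiv : HasFDerivWithinAt (φ ∘ γ) (φ'.comp R) T (A x₀) := by
    refine (HasFDerivAt.comp (A x₀) ?_ hγ'.hasFDerivAt).hasFDerivWithinAt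
    rw [hγ0]
    exact hφ.hasFDerivAt
  have hcone : (Pi.single i 1 : ι → ℝ) ∈ posTangentConeAt T (A x₀) := by
    refine mem_posTangentConeAt_of_frequently_mem (Eventually.frequently ?_)
    filter_upwards [self_mem_nhdsWithin] with t ht j
    rcases eq_or_ne j i with rfl | hji
    · simpa [hi] using (le_of_lt ht)
    · simp [hji]
  have hnonneg := hφγ.hasFDerivWithinAt_nonneg hderiv hcone
  simpa [hΛ, hR, Pi.single_apply] using hnonneg



/-- Karush-Kuhn-Tucker necessary conditions under LICQ. -/
theorem kkt_necessary_conditions {n me mi : ℕ}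
    (f : (Fin n → ℝ) → ℝ)
    (c : (Fin n → ℝ) → Fin me → ℝ)
    (g : (Fin n → ℝ) → Fin mi → ℝ)
    (hf : ContDiff ℝ 1 f)
    (hc : ∀ i, ContDiff ℝ 1 (fun x => c x i))
    (hg : ∀ i, ContDiff ℝ 1 (fun x => g x i))
    (xstar : Fin n → ℝ)
    (hfeas_eq : c xstar = 0) (hfeas_ineq : ∀ i, 0 ≤ g xstar i)
    (hmin : IsLocalMinOn f {x | c x = 0 ∧ ∀ i, 0 ≤ g x i} xstar)
    (hLICQ : LinearIndependent ℝ
      (fun j : Fin me ⊕ {i : Fin mi // g xstar i = 0} =>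
        Sum.elim (fun i => fderiv ℝ (fun x => c x i) xstar)
                 (fun i => fderiv ℝ (fun x => g x i.1) xstar) j)) :
    ∃ (ψ : Fin me → ℝ) (μ : Fin mi → ℝ),
      (∀ i, 0 ≤ μ i) ∧
      fderiv ℝ f xstar =
        ∑ i, ψ i • fderiv ℝ (fun x => c x i) xstar +
        ∑ i, μ i • fderiv ℝ (fun x => g x i) xstar ∧
      ∀ i, μ i * g xstar i = 0 := by
  classical
  let a : Fin me ⊕ {i : Fin mi // g xstar i = 0} → (Fin n → ℝ) → ℝ :=
    Sum.elim (fun i x => c x i) (fun i x => g x i.1)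
  have ha : ∀ j, HasStrictFDerivAt (a j)
      (Sum.elim (fun i => fderiv ℝ (fun x => c x i) xstar)
        (fun i : {i : Fin mi // g xstar i = 0} => fderiv ℝ (fun x => g x i.1) xstar) j) xstar := by
    rintro (i | i)
    · exact (hc i).contDiffAt.hasStrictFDerivAt one_ne_zero
    · exact (hg i).contDiffAt.hasStrictFDerivAt one_ne_zero
  have hactive : IsLocalMinOn f
      {x | ∀ j, a j xstar ≤ a j x ∧ (j ∈ Set.range Sum.inl → a j x = a j xstar)} xstar := by
    have hinactive : ∀ᶠ x in 𝓝 xstar, ∀ i, g xstar i ≠ 0 → 0 ≤ g x i := by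
      refine eventually_all.2 fun i => ?_
      by_cases hi : g xstar i = 0
      · simp [hi]
      · filter_upwards [(hg i).continuous.continuousAt.eventually
          (lt_mem_nhds (lt_of_le_of_ne (hfeas_ineq i) (Ne.symm hi)))] with x hx _
        exact le_of_lt hx
    refine hmin.filter_mono ?_
    refine le_inf nhdsWithin_le_nhds (le_principal_iff.2 ?_)
    filter_upwards [self_mem_nhdsWithin, nhdsWithin_le_nhds hinactive] with x hx hxi
    refine ⟨funext fun i => ?_, fun i => ?_⟩
    · have h := (hx (Sum.inl i)).2 ⟨i, rfl⟩
      simpa [a, hfeas_eq] using h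
    · by_cases hi : g xstar i = 0
      · have h := (hx (Sum.inr ⟨i, hi⟩)).1
        simpa [a, hi] using h
      · exact hxi i hi
  obtain ⟨Λ, hΛ, hsum⟩ := hactive.exists_multipliers_of_linearIndependent ha
    (hf.contDiffAt.hasStrictFDerivAt one_ne_zero) hLICQ
  refine ⟨fun i => Λ (Sum.inl i), fun i => if h : g xstar i = 0 then Λ (Sum.inr ⟨i, h⟩) else 0,
    fun i => ?_, ?_, fun i => ?_⟩
  · dsimp only
    split_ifs with h
    · exact hΛ _ (by simp)
    · exact le_rfl
  · rw [hsum, Fintype.sum_sum_type]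
    congr 1
    rw [← Finset.sum_subset (Finset.filter_subset (fun i => g xstar i = 0) Finset.univ)
      (by intro i _ hi; simp_all), Finset.sum_subtype _ (p := fun i => g xstar i = 0) (by simp)]
    exact Finset.sum_congr rfl fun i _ => by simp [i.2]
  · by_cases h : g xstar i = 0 <;> simp [h]
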